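/- There exist measurable functions u* : X → ℝ₊ and v* : Y → ℝ₊ such that the unique minimizer π* of KL(·|K) over Π(μ̂,ν̂) satisfies π* = (u*⊗v*)·K, i.e. dπ*/dK(x,y) = u*(x)·v*(y). Moreover u* and v* are unique μ-a.e. and ν-a.e. up to the rescaling (u*,v*) ↦ (λ·u*, λ⁻¹·v*) for λ > 0. -/

import Mathlib

open MeasureTheory ENNReal Filter Topology

noncomputable section

/-- `phi s = s * log s - s + 1` (note `phi 0 = 1` since `Real.log 0 = 0`);
this is the integrand of the Kullback--Leibler divergence. -/
def phi (s : ℝ) : ℝ := s * Real.log s - s + 1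

open Classical in
/-- Kullback--Leibler divergence `KL(ρ|σ) ∈ [0,∞]`: `∫ phi (dρ/dσ) dσ` if `ρ ≪ σ`,
and `∞` otherwise (nonnegativity of `ρ` is automatic for measures). -/
def KL {Z : Type*} [MeasurableSpace Z] (ρ σ : Measure Z) : ℝ≥0∞ :=
  if ρ ≪ σ then ∫⁻ z, ENNReal.ofReal (phi ((ρ.rnDeriv σ) z).toReal) ∂σ else ⊤

/-- The set `Π(μh, νh)` of transport plans with marginals `μh` and `νh`. -/
def Coupling {X Y : Type*} [MeasurableSpace X] [MeasurableSpace Y]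
    (μh : Measure X) (νh : Measure Y) : Set (Measure (X × Y)) :=
  {π | π.map Prod.fst = μh ∧ π.map Prod.snd = νh}

/-- The Gibbs kernel measure `K = exp(-c/ε) ⋅ (μ ⊗ ν)`. -/
def Kmeas {X Y : Type*} [MeasurableSpace X] [MeasurableSpace Y]
    (μ : Measure X) (ν : Measure Y) [SFinite ν] (c : X × Y → ℝ) (ε : ℝ) : Measure (X × Y) :=
  (μ.prod ν).withDensity fun p => ENNReal.ofReal (Real.exp (-c p / ε))

/-- The product density `(u ⊗ v)(x,y) = u x * v y`, as an `ℝ≥0∞`-valued density. -/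
def prodDensity {X Y : Type*} (u : X → ℝ) (v : Y → ℝ) : X × Y → ℝ≥0∞ :=
  fun p => ENNReal.ofReal (u p.1 * v p.2)

/-- `L^∞₊(μ)`: measurable, a.e. nonnegative, essentially bounded functions. -/
def LinftyPlus {Z : Type*} [MeasurableSpace Z] (μ : Measure Z) (u : Z → ℝ) : Prop :=
  Measurable u ∧ (∀ᵐ z ∂μ, 0 ≤ u z) ∧ ∃ C : ℝ, ∀ᵐ z ∂μ, u z ≤ C

lemma measurable_phi : Measurable phi := by
  unfold phi
  fun_prop

/-- The exact convexity defect of `phi` at a positive point, bounded by a quadratic. -/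
lemma phi_le_tangent {a b : ℝ} (ha : 0 < a) (hb : 0 ≤ b) :
    phi b ≤ phi a + (b - a) * Real.log a + (b - a) ^ 2 / a := by
  have key : b * Real.log b - b * Real.log a ≤ b * (b / a - 1) := by
    rcases hb.eq_or_lt with rfl | hb
    · simp
    · rw [← mul_sub, ← Real.log_div hb.ne' ha.ne']
      exact mul_le_mul_of_nonneg_left (Real.log_le_sub_one_of_pos (by positivity)) hb.le
  have h2 : (b - a) ^ 2 / a = b * (b / a - 1) - b + a := by
    field_simp
    ring
  unfold phi
  rw [h2]
  linarith

lemma phi_le_sq {b : ℝ} (hb : 0 ≤ b) : phi b ≤ (b - 1) ^ 2 := by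
  simpa [phi] using phi_le_tangent one_pos hb

lemma phi_nonneg {s : ℝ} (hs : 0 ≤ s) : 0 ≤ phi s := by
  rcases hs.eq_or_lt with rfl | hs
  · simp [phi]
  · have h := phi_le_tangent hs hs.le
    have := Real.one_sub_inv_le_log_of_pos hs
    have h3 : s * (1 - s⁻¹) ≤ s * Real.log s := mul_le_mul_of_nonneg_left this hs.le
    have h4 : s * (1 - s⁻¹) = s - 1 := by field_simp
    unfold phi
    linarith

/-- Convexity of `phi`, with the entropic gain made by leaving the point `0`. -/
lemma phi_mix_le {a b t : ℝ} (ha : 0 ≤ a) (hb : 0 ≤ b) (ht : 0 < t) (ht1 : t ≤ 1) :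
    phi ((1 - t) * a + t * b) ≤
      (1 - t) * phi a + t * phi b + t * Real.log t * (if a = 0 then b else 0) := by
  split_ifs with h
  · subst h
    rcases hb.eq_or_lt with rfl | hb
    · simp [phi]
    · simp only [phi, mul_zero, zero_add, Real.log_mul ht.ne' hb.ne']
      apply le_of_eq
      ring
  · have := Real.convexOn_mul_log.2 (Set.mem_Ici.2 ha) (Set.mem_Ici.2 hb) (sub_nonneg.2 ht1)
      ht.le (by ring)
    simp only [smul_eq_mul] at this
    unfold phi
    linarith

lemma nonneg_of_forall_small {I B δ : ℝ} (hδ : 0 < δ) (hB : 0 ≤ B)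
    (h : ∀ t, 0 < t → t ≤ δ → 0 ≤ t * I + t ^ 2 * B) : 0 ≤ I := by
  by_contra! hI
  have hpos : 0 < -I / (2 * (B + 1)) := by
    apply div_pos <;> linarith
  have ht : 0 < min δ (-I / (2 * (B + 1))) := lt_min hδ hpos
  have h1 := h _ ht (min_le_left _ _)
  have h2 : min δ (-I / (2 * (B + 1))) * (2 * (B + 1)) ≤ -I :=
    (le_div_iff₀ (by linarith)).1 (min_le_right _ _)
  generalize min δ (-I / (2 * (B + 1))) = t at *
  have h3 : 0 ≤ t * (I + t * B) := by linarith
  have h4 := nonneg_of_mul_nonneg_right h3 ht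
  nlinarith

section FirstOrder

variable {Z : Type*} [MeasurableSpace Z] {K : Measure Z}

lemma integrable_of_measurable_bound [IsFiniteMeasure K] {f : Z → ℝ} (hf : Measurable f) {C : ℝ}
    (hC : ∀ z, |f z| ≤ C) : Integrable f K :=
  Integrable.of_bound hf.aestronglyMeasurable C (.of_forall hC)

/-- First-order optimality of an entropy minimizer along a bounded perturbation supported
where the density is bounded away from `0` and `∞`. -/
lemma integral_mul_log_eq_zero [IsFiniteMeasure K] {h q ℓ : Z → ℝ} (hh : Measurable h) (hh0 : ∀ z, 0 ≤ h z)
    (hφ : Integrable (fun z => phi (h z)) K) (hq : Measurable q) (hℓ : Measurable ℓ)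
    {a C D : ℝ} (ha : 0 < a) (hC : 0 < C) (hqC : ∀ z, |q z| ≤ C) (hℓD : ∀ z, |ℓ z| ≤ D)
    (hsupp : ∀ z, q z ≠ 0 → a ≤ h z ∧ ℓ z = Real.log (h z))
    (hopt : ∀ t : ℝ, (∀ z, 0 ≤ h z + t * q z) →
      Integrable (fun z => phi (h z + t * q z)) K →
      ∫ z, phi (h z) ∂K ≤ ∫ z, phi (h z + t * q z) ∂K) :
    ∫ z, q z * ℓ z ∂K = 0 := by
  have hqi : Integrable (fun z => q z * ℓ z) K := by
    refine integrable_of_measurable_bound (hq.mul hℓ) (C := C * D) fun z => ?_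
    rw [abs_mul]
    exact mul_le_mul (hqC z) (hℓD z) (abs_nonneg _) hC.le
  have key : ∀ t : ℝ, |t| ≤ a / C →
      0 ≤ t * ∫ z, q z * ℓ z ∂K + t ^ 2 * (C ^ 2 / a * K.real Set.univ) := by
    intro t ht
    have htC : |t| * C ≤ a := (le_div_iff₀ hC).1 ht
    have hnn : ∀ z, 0 ≤ h z + t * q z := by
      intro z
      by_cases hz : q z = 0
      · simpa [hz] using hh0 z
      · have h1 := (hsupp z hz).1
        have h2 : |t * q z| ≤ a := by
          rw [abs_mul]
          exact (mul_le_mul_of_nonneg_left (hqC z) (abs_nonneg t)).trans htC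
        have := (abs_le.1 h2).1
        linarith
    have hle : ∀ z, phi (h z + t * q z) ≤ phi (h z) + t * (q z * ℓ z) + t ^ 2 * (C ^ 2 / a) := by
      intro z
      by_cases hz : q z = 0
      · simp only [hz, mul_zero, add_zero, zero_mul]
        have : 0 ≤ t ^ 2 * (C ^ 2 / a) := by positivity
        linarith
      · obtain ⟨h1, h2⟩ := hsupp z hz
        have h3 := phi_le_tangent (ha.trans_le h1) (hnn z)
        have h4 : (h z + t * q z - h z) ^ 2 / h z ≤ t ^ 2 * (C ^ 2 / a) := by
          rw [add_sub_cancel_left, mul_pow, mul_div_assoc]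
          have : q z ^ 2 ≤ C ^ 2 := sq_le_sq' (abs_le.1 (hqC z)).1 (abs_le.1 (hqC z)).2
          gcongr
        rw [h2]
        nlinarith
    have hsum : Integrable (fun z => phi (h z) + t * (q z * ℓ z)) K := hφ.add (hqi.const_mul t)
    have hint : Integrable (fun z => phi (h z) + t * (q z * ℓ z) + t ^ 2 * (C ^ 2 / a)) K :=
      hsum.add (integrable_const _)
    have hint' : Integrable (fun z => phi (h z + t * q z)) K := by
      refine hint.mono' (measurable_phi.comp
        (hh.add (hq.const_mul t))).aestronglyMeasurable (.of_forall fun z => ?_)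
      rw [Real.norm_of_nonneg (phi_nonneg (hnn z))]
      exact hle z
    have h5 := (hopt t hnn hint').trans (integral_mono hint' hint hle)
    rw [integral_add hsum (integrable_const _),
      integral_add hφ (hqi.const_mul t), integral_const_mul, integral_const, smul_eq_mul] at h5
    linarith
  have hB : 0 ≤ C ^ 2 / a * K.real Set.univ := by positivity
  have hδ : 0 < a / C := by positivity
  apply le_antisymm
  · rw [← neg_nonneg]
    refine nonneg_of_forall_small hδ hB fun t ht htδ => ?_
    have := key (-t) (by rwa [abs_neg, abs_of_pos ht])
    linarith
  · exact nonneg_of_forall_small hδ hB fun t ht htδ => key t (by rwa [abs_of_pos ht])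

/-- An entropy minimizer charges every set charged by an admissible competitor of finite
entropy. -/
lemma ae_eq_zero_of_minimizer {h g : Z → ℝ} (hh : Measurable h) (hh0 : ∀ z, 0 ≤ h z)
    (hφ : Integrable (fun z => phi (h z)) K) (hg : Measurable g) (hg0 : ∀ z, 0 ≤ g z)
    (hgi : Integrable g K) (hφg : Integrable (fun z => phi (g z)) K)
    (hopt : ∀ t : ℝ, 0 < t → t ≤ 1 →
      Integrable (fun z => phi ((1 - t) * h z + t * g z)) K →
      ∫ z, phi (h z) ∂K ≤ ∫ z, phi ((1 - t) * h z + t * g z) ∂K) :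
    ∀ᵐ z ∂K, h z = 0 → g z = 0 := by
  set r : Z → ℝ := fun z => if h z = 0 then g z else 0 with hr
  have hr0 : ∀ z, 0 ≤ r z := fun z => by
    simp only [hr]; split_ifs; exacts [hg0 z, le_rfl]
  have hrm : Measurable r := Measurable.ite (hh (measurableSet_singleton 0)) hg measurable_const
  have hri : Integrable r K := hgi.mono' hrm.aestronglyMeasurable (.of_forall fun z => by
    rw [Real.norm_of_nonneg (hr0 z)]
    simp only [hr]; split_ifs; exacts [le_rfl, hg0 z])
  have key : ∀ t : ℝ, 0 < t → t ≤ 1 → ∫ z, phi (h z) ∂K ≤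
      ∫ z, phi (g z) ∂K + Real.log t * ∫ z, r z ∂K := by
    intro t ht ht1
    have hle : ∀ z, phi ((1 - t) * h z + t * g z) ≤
        (1 - t) * phi (h z) + t * phi (g z) + t * Real.log t * r z :=
      fun z => phi_mix_le (hh0 z) (hg0 z) ht ht1
    have hsum : Integrable (fun z => (1 - t) * phi (h z) + t * phi (g z)) K :=
      (hφ.const_mul (1 - t)).add (hφg.const_mul t)
    have hint := hsum.add (hri.const_mul (t * Real.log t))
    have hint' : Integrable (fun z => phi ((1 - t) * h z + t * g z)) K := by
      refine hint.mono' (measurable_phi.comp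
        ((hh.const_mul _).add (hg.const_mul t))).aestronglyMeasurable (.of_forall fun z => ?_)
      rw [Real.norm_of_nonneg (phi_nonneg (add_nonneg
        (mul_nonneg (sub_nonneg.2 ht1) (hh0 z)) (mul_nonneg ht.le (hg0 z))))]
      exact hle z
    have h5 := (hopt t ht ht1 hint').trans (integral_mono hint' hint hle)
    simp only [Pi.add_apply] at h5
    rw [integral_add hsum (hri.const_mul _),
      integral_add (hφ.const_mul _) (hφg.const_mul t), integral_const_mul, integral_const_mul,
      integral_const_mul] at h5
    refine le_of_mul_le_mul_left ?_ ht
    linarith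
  have hI : ∫ z, r z ∂K = 0 := by
    by_contra hne
    have hpos : 0 < ∫ z, r z ∂K := lt_of_le_of_ne (integral_nonneg hr0) (Ne.symm hne)
    have hφh0 : 0 ≤ ∫ z, phi (h z) ∂K := integral_nonneg fun z => phi_nonneg (hh0 z)
    have hφg0 : 0 ≤ ∫ z, phi (g z) ∂K := integral_nonneg fun z => phi_nonneg (hg0 z)
    set I := ∫ z, r z ∂K
    set G := ∫ z, phi (g z) ∂K
    have h1 := key (Real.exp (-((G + 1) / I))) (Real.exp_pos _)
      (Real.exp_le_one_iff.2 (neg_nonpos.2 (by positivity)))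
    rw [Real.log_exp, neg_mul, div_mul_cancel₀ _ hpos.ne'] at h1
    linarith
  filter_upwards [(integral_eq_zero_iff_of_nonneg hr0 hri).1 hI] with z hz hhz
  simpa [hr, hhz] using hz

end FirstOrder

section Exchange

variable {X Y : Type*} [MeasurableSpace X] [MeasurableSpace Y]

/-- Exchange the second coordinates of two points of `X × Y`. -/
def exchangeSnd (p : (X × Y) × (X × Y)) : (X × Y) × (X × Y) :=
  ((p.1.1, p.2.2), (p.2.1, p.1.2))

lemma measurePreserving_exchangeSnd (μ : Measure X) (ν : Measure Y) [SFinite μ] [SFinite ν] :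
    MeasurePreserving exchangeSnd ((μ.prod ν).prod (μ.prod ν)) ((μ.prod ν).prod (μ.prod ν)) := by
  have hinner : MeasurePreserving (fun q : Y × (X × Y) => (q.2.2, (q.2.1, q.1)))
      (ν.prod (μ.prod ν)) (ν.prod (μ.prod ν)) := by
    have h1 : MeasurePreserving Prod.swap (ν.prod (μ.prod ν)) ((μ.prod ν).prod ν) :=
      Measure.measurePreserving_swap
    have h2 := measurePreserving_prodAssoc μ ν ν
    have h3 : MeasurePreserving (Prod.map id Prod.swap) (μ.prod (ν.prod ν)) (μ.prod (ν.prod ν)) :=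
      (MeasurePreserving.id μ).prod Measure.measurePreserving_swap
    have h4 := (measurePreserving_prodAssoc μ ν ν).symm
    have h5 : MeasurePreserving Prod.swap ((μ.prod ν).prod ν) (ν.prod (μ.prod ν)) :=
      Measure.measurePreserving_swap
    exact h5.comp (h4.comp (h3.comp (h2.comp h1)))
  have h1 := measurePreserving_prodAssoc μ ν (μ.prod ν)
  exact h1.symm.comp (((MeasurePreserving.id μ).prod hinner).comp h1)

/-- If a bounded function `ℓ` is orthogonal to all bounded functions that vanish off `E` and have
vanishing marginals, then it is additively cyclic on quadruples in `E`. -/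
lemma ae_add_eq_add_of_orthogonal (μ : Measure X) (ν : Measure Y)
    [IsProbabilityMeasure μ] [IsProbabilityMeasure ν] {E : Set (X × Y)} (hE : MeasurableSet E)
    {ℓ : X × Y → ℝ} (hℓ : Measurable ℓ) {D : ℝ} (hD : ∀ z, |ℓ z| ≤ D)
    (H : ∀ w : X × Y → ℝ, Measurable w → (∃ C, ∀ z, |w z| ≤ C) → (∀ z, z ∉ E → w z = 0) →
      (∀ A, MeasurableSet A → ∫ z in Prod.fst ⁻¹' A, w z ∂μ.prod ν = 0) →
      (∀ B, MeasurableSet B → ∫ z in Prod.snd ⁻¹' B, w z ∂μ.prod ν = 0) →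
      ∫ z, w z * ℓ z ∂μ.prod ν = 0) :
    ∀ᵐ p ∂(μ.prod ν).prod (μ.prod ν), p.1 ∈ E → p.2 ∈ E → (p.1.1, p.2.2) ∈ E →
      (p.2.1, p.1.2) ∈ E → ℓ p.1 + ℓ p.2 = ℓ (p.1.1, p.2.2) + ℓ (p.2.1, p.1.2) := by
  set m := μ.prod ν
  set e : X × Y → ℝ := E.indicator 1 with he
  have hem : Measurable e := measurable_one.indicator hE
  have he0 : ∀ z, 0 ≤ e z := fun z => Set.indicator_nonneg (fun _ _ => zero_le_one) z
  have he1 : ∀ z, e z ≤ 1 := fun z => Set.indicator_le_self' (fun _ _ => zero_le_one) z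
  set d : (X × Y) × (X × Y) → ℝ := fun p =>
    ℓ p.1 + ℓ p.2 - ℓ (p.1.1, p.2.2) - ℓ (p.2.1, p.1.2) with hd
  set s : (X × Y) × (X × Y) → ℝ := fun p =>
    e p.1 * e p.2 * (e (p.1.1, p.2.2) * e (p.2.1, p.1.2)) * d p with hs
  have hdm : Measurable d := by fun_prop
  have hsm : Measurable s := by fun_prop
  have hdb : ∀ p, |d p| ≤ 4 * D := by
    intro p
    have h1 := abs_le.1 (hD p.1)
    have h2 := abs_le.1 (hD p.2)
    have h3 := abs_le.1 (hD (p.1.1, p.2.2))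
    have h4 := abs_le.1 (hD (p.2.1, p.1.2))
    rw [abs_le]
    constructor <;> simp only [hd] <;> linarith
  have hsb : ∀ p, |s p| ≤ 4 * D := by
    intro p
    simp only [hs]
    rw [abs_mul]
    have h1 : |e p.1 * e p.2 * (e (p.1.1, p.2.2) * e (p.2.1, p.1.2))| ≤ 1 := by
      rw [abs_of_nonneg (mul_nonneg (mul_nonneg (he0 _) (he0 _)) (mul_nonneg (he0 _) (he0 _)))]
      exact mul_le_one₀ (mul_le_one₀ (he1 _) (he0 _) (he1 _)) (mul_nonneg (he0 _) (he0 _))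
        (mul_le_one₀ (he1 _) (he0 _) (he1 _))
    calc _ ≤ 1 * |d p| := mul_le_mul_of_nonneg_right h1 (abs_nonneg _)
      _ ≤ 4 * D := by rw [one_mul]; exact hdb p
  have hmul : ∀ {g : (X × Y) × (X × Y) → ℝ} {b : ℝ}, Measurable g → (∀ p, |g p| ≤ b) →
      Integrable (fun p => s p * g p) (m.prod m) := by
    intro g b hg hb
    refine integrable_of_measurable_bound (hsm.mul hg) (C := 4 * D * b) fun p => ?_
    rw [abs_mul]
    exact mul_le_mul (hsb p) (hb p) (abs_nonneg _) ((abs_nonneg _).trans (hsb p))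
  have hsmul : ∀ {g : X × Y → ℝ}, Measurable g → Measurable fun p => s p * g p.1 :=
    fun hg => hsm.mul (hg.comp measurable_fst)
  have hT := measurePreserving_exchangeSnd μ ν
  have hS : MeasurePreserving Prod.swap (m.prod m) (m.prod m) := Measure.measurePreserving_swap
  have hinv : ∀ {T : (X × Y) × (X × Y) → (X × Y) × (X × Y)}, MeasurePreserving T (m.prod m)
      (m.prod m) → ∀ {f : (X × Y) × (X × Y) → ℝ}, Measurable f →
      ∫ p, f (T p) ∂m.prod m = ∫ p, f p ∂m.prod m := by
    intro T hT f hf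
    conv_rhs => rw [← hT.map_eq]
    exact (integral_map hT.measurable.aemeasurable hf.aestronglyMeasurable).symm
  have hsT : ∀ p, s (exchangeSnd p) = -s p := fun p => by
    simp only [hs, hd, exchangeSnd]
    ring
  have hsS : ∀ p, s p.swap = s p := fun p => by
    simp only [hs, hd, Prod.fst_swap, Prod.snd_swap]
    ring
  set w : X × Y → ℝ := fun z => ∫ z', s (z, z') ∂m with hw
  have hwm : Measurable w := hsm.stronglyMeasurable.integral_prod_right'.measurable
  have hwmul : ∀ {g : X × Y → ℝ} {b : ℝ}, Measurable g → (∀ z, |g z| ≤ b) →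
      ∫ z, w z * g z ∂m = ∫ p, s p * g p.1 ∂m.prod m := by
    intro g b hg hb
    have hi : Integrable (fun p => s p * g p.1) (m.prod m) :=
      hmul (hg.comp measurable_fst) fun p => hb p.1
    rw [integral_prod _ hi]
    exact integral_congr_ae (.of_forall fun z => (integral_mul_const _ _).symm)
  have hanti : ∀ {T : (X × Y) × (X × Y) → (X × Y) × (X × Y)}, MeasurePreserving T (m.prod m)
      (m.prod m) → (∀ p, s (T p) = -s p) → ∀ {g : X × Y → ℝ}, Measurable g →
      ∫ p, s p * g (T p).1 ∂m.prod m = -∫ p, s p * g p.1 ∂m.prod m := by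
    intro T hT hsT g hg
    rw [← hinv hT (hsmul hg), ← integral_neg]
    refine integral_congr_ae (.of_forall fun p => ?_)
    simp [hsT]
  have hTx : MeasurePreserving (fun p => (exchangeSnd p).swap) (m.prod m) (m.prod m) := hS.comp hT
  have hsTx : ∀ p, s (exchangeSnd p).swap = -s p := fun p => by rw [hsS, hsT]
  have hind : ∀ {A : Set (X × Y)}, MeasurableSet A →
      ∫ z in A, w z ∂m = ∫ z, w z * A.indicator 1 z ∂m := by
    intro A hA
    rw [← integral_indicator hA]
    refine integral_congr_ae (.of_forall fun z => ?_)
    by_cases hz : z ∈ A <;> simp [hz]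
  have hindb : ∀ (A : Set (X × Y)) z, |A.indicator (1 : X × Y → ℝ) z| ≤ 1 := by
    intro A z
    by_cases hz : z ∈ A <;> simp [hz]
  have horth := H w hwm
    ⟨4 * D, fun z => by
      have := norm_integral_le_of_norm_le_const (μ := m) (f := fun z' => s (z, z'))
        (.of_forall fun z' => hsb (z, z'))
      simpa using this⟩
    (fun z hz => by simp [hw, hs, he, hz])
    (fun A hA => by
      have hA' : MeasurableSet (Prod.fst ⁻¹' A : Set (X × Y)) := measurable_fst hA
      have h1 := hanti hT hsT (measurable_one.indicator hA' (f := (1 : X × Y → ℝ)))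
      have h2 : ∀ p : (X × Y) × (X × Y), (Prod.fst ⁻¹' A).indicator (1 : X × Y → ℝ)
          (exchangeSnd p).1 = (Prod.fst ⁻¹' A).indicator (1 : X × Y → ℝ) p.1 := fun p => rfl
      simp only [h2] at h1
      rw [hind hA', hwmul (measurable_one.indicator hA') (hindb _)]
      linarith)
    (fun B hB => by
      have hB' : MeasurableSet (Prod.snd ⁻¹' B : Set (X × Y)) := measurable_snd hB
      have h1 := hanti hTx hsTx (measurable_one.indicator hB' (f := (1 : X × Y → ℝ)))
      have h2 : ∀ p : (X × Y) × (X × Y), (Prod.snd ⁻¹' B).indicator (1 : X × Y → ℝ)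
          (exchangeSnd p).swap.1 = (Prod.snd ⁻¹' B).indicator (1 : X × Y → ℝ) p.1 := fun p => rfl
      simp only [h2] at h1
      rw [hind hB', hwmul (measurable_one.indicator hB') (hindb _)]
      linarith)
  rw [hwmul hℓ hD] at horth
  have hsd : ∫ p, s p * d p ∂m.prod m = 0 := by
    have i1 : Integrable (fun p => s p * ℓ p.1) (m.prod m) :=
      hmul (hℓ.comp measurable_fst) fun p => hD p.1
    have i2 : Integrable (fun p => s p * ℓ p.2) (m.prod m) :=
      hmul (hℓ.comp measurable_snd) fun p => hD p.2
    have i3 : Integrable (fun p => s p * ℓ (exchangeSnd p).1) (m.prod m) :=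
      hmul ((hℓ.comp measurable_fst).comp hT.measurable) fun p => hD _
    have i4 : Integrable (fun p => s p * ℓ (exchangeSnd p).swap.1) (m.prod m) :=
      hmul ((hℓ.comp measurable_fst).comp hTx.measurable) fun p => hD _
    have e2 : ∫ p, s p * ℓ p.2 ∂m.prod m = 0 := by
      rw [← horth, ← hinv hS (hsmul hℓ)]
      refine integral_congr_ae (.of_forall fun p => ?_)
      simp [hsS]
    have e3 := hanti hT hsT hℓ
    have e4 := hanti hTx hsTx hℓ
    have hsplit : ∀ p, s p * d p = s p * ℓ p.1 + s p * ℓ p.2 - s p * ℓ (exchangeSnd p).1 -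
        s p * ℓ (exchangeSnd p).swap.1 := fun p => by
      simp only [hd, exchangeSnd, Prod.fst_swap]
      ring
    have i12 : Integrable (fun p => s p * ℓ p.1 + s p * ℓ p.2) (m.prod m) := i1.add i2
    have i123 : Integrable (fun p => s p * ℓ p.1 + s p * ℓ p.2 - s p * ℓ (exchangeSnd p).1)
      (m.prod m) := i12.sub i3
    simp only [hsplit]
    rw [integral_sub i123 i4, integral_sub i12 i3, integral_add i1 i2, e2, e3, e4, horth]
    simp
  have hsd0 : ∀ p, 0 ≤ s p * d p := fun p => by
    simp only [hs]
    rw [mul_assoc _ (d p) (d p)]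
    exact mul_nonneg (mul_nonneg (mul_nonneg (he0 _) (he0 _)) (mul_nonneg (he0 _) (he0 _)))
      (mul_self_nonneg _)
  filter_upwards [(integral_eq_zero_iff_of_nonneg hsd0 (hmul hdm hdb)).1 hsd] with p hp h1 h2 h3 h4
  simp only [hs, he, Set.indicator_of_mem h1, Set.indicator_of_mem h2, Set.indicator_of_mem h3,
    Set.indicator_of_mem h4, Pi.one_apply, one_mul, Pi.zero_apply, mul_self_eq_zero, hd] at hp
  linarith

end Exchange

section Density

variable {Z : Type*} [MeasurableSpace Z]

lemma KL_withDensity {K : Measure Z} [IsFiniteMeasure K] {g : Z → ℝ} (hg : Measurable g)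
    (hg0 : ∀ z, 0 ≤ g z) :
    KL (K.withDensity fun z => ENNReal.ofReal (g z)) K =
      ∫⁻ z, ENNReal.ofReal (phi (g z)) ∂K := by
  rw [KL, if_pos (withDensity_absolutelyContinuous _ _)]
  refine lintegral_congr_ae ?_
  filter_upwards [K.rnDeriv_withDensity hg.ennreal_ofReal] with z hz
  rw [hz, ENNReal.toReal_ofReal (hg0 z)]

lemma integrable_phi_and_integral_le {K : Measure Z} {h g : Z → ℝ} (hh : Measurable h)
    (hh0 : ∀ z, 0 ≤ h z) (hg0 : ∀ z, 0 ≤ g z)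
    (hφg : Integrable (fun z => phi (g z)) K)
    (hle : ∫⁻ z, ENNReal.ofReal (phi (h z)) ∂K ≤ ∫⁻ z, ENNReal.ofReal (phi (g z)) ∂K) :
    Integrable (fun z => phi (h z)) K ∧ ∫ z, phi (h z) ∂K ≤ ∫ z, phi (g z) ∂K := by
  have hm : AEStronglyMeasurable (fun z => phi (h z)) K :=
    (measurable_phi.comp hh).aestronglyMeasurable
  have hh1 : 0 ≤ᵐ[K] fun z => phi (h z) := .of_forall fun z => phi_nonneg (hh0 z)
  have hg1 : 0 ≤ᵐ[K] fun z => phi (g z) := .of_forall fun z => phi_nonneg (hg0 z)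
  rw [← ofReal_integral_eq_lintegral_ofReal hφg hg1] at hle
  have hφh : Integrable (fun z => phi (h z)) K :=
    ⟨hm, (hasFiniteIntegral_iff_ofReal hh1).2 (hle.trans_lt ENNReal.ofReal_lt_top)⟩
  refine ⟨hφh, ?_⟩
  rwa [← ofReal_integral_eq_lintegral_ofReal hφh hh1,
    ENNReal.ofReal_le_ofReal_iff (integral_nonneg fun z => phi_nonneg (hg0 z))] at hle

/-- A measure with essentially bounded density has an everywhere bounded, nonnegative, real
density. -/
lemma exists_bounded_density {μ ρ : Measure Z} [SigmaFinite μ] (hac : ρ ≪ μ)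
    (hbd : ∃ C : ℝ≥0∞, C ≠ ⊤ ∧ ∀ᵐ z ∂μ, ρ.rnDeriv μ z ≤ C) :
    ∃ (f : Z → ℝ) (C : ℝ), Measurable f ∧ (∀ z, 0 ≤ f z) ∧ (∀ z, f z ≤ C) ∧
      ρ = μ.withDensity fun z => ENNReal.ofReal (f z) := by
  obtain ⟨C, hC, hle⟩ := hbd
  have : SFinite ρ := sFinite_of_absolutelyContinuous hac
  refine ⟨fun z => (min (ρ.rnDeriv μ z) C).toReal, C.toReal, by fun_prop, fun z => toReal_nonneg,
    fun z => ENNReal.toReal_mono hC (min_le_right _ _), ?_⟩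
  conv_lhs => rw [← Measure.withDensity_rnDeriv_eq ρ μ hac]
  refine withDensity_congr_ae ?_
  filter_upwards [hle] with z hz
  rw [ENNReal.ofReal_toReal (ne_top_of_le_ne_top hC (min_le_right _ _)), min_eq_left hz]

lemma withDensity_ofReal_apply {K : Measure Z} {g : Z → ℝ} (hg0 : ∀ z, 0 ≤ g z)
    (hgi : Integrable g K) {s : Set Z} (hs : MeasurableSet s) :
    (K.withDensity fun z => ENNReal.ofReal (g z)) s = ENNReal.ofReal (∫ z in s, g z ∂K) := by
  rw [withDensity_apply _ hs,
    ofReal_integral_eq_lintegral_ofReal hgi.integrableOn (.of_forall fun z => hg0 z)]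

lemma setIntegral_div_withDensity {m : Measure Z} {k w : Z → ℝ} (hk : Measurable k)
    (hk0 : ∀ z, 0 < k z) {s : Set Z} (hs : MeasurableSet s) :
    ∫ z in s, w z / k z ∂(m.withDensity fun z => ENNReal.ofReal (k z)) = ∫ z in s, w z ∂m := by
  rw [setIntegral_withDensity_eq_setIntegral_toReal_smul hk.ennreal_ofReal
    (.of_forall fun z => ENNReal.ofReal_lt_top) _ hs]
  refine integral_congr_ae (.of_forall fun z => ?_)
  simp only [smul_eq_mul, ENNReal.toReal_ofReal (hk0 z).le]
  exact mul_div_cancel₀ _ (hk0 z).ne'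

end Density

section Marginals

variable {X Y : Type*} [MeasurableSpace X] [MeasurableSpace Y]

lemma withDensity_mem_Coupling_iff {K : Measure (X × Y)} {g : X × Y → ℝ}
    (hg0 : ∀ z, 0 ≤ g z) (hgi : Integrable g K)
    {μh : Measure X} {νh : Measure Y} [IsFiniteMeasure μh] [IsFiniteMeasure νh] :
    (K.withDensity fun z => ENNReal.ofReal (g z)) ∈ Coupling μh νh ↔
      (∀ A, MeasurableSet A → ∫ z in Prod.fst ⁻¹' A, g z ∂K = μh.real A) ∧
      (∀ B, MeasurableSet B → ∫ z in Prod.snd ⁻¹' B, g z ∂K = νh.real B) := by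
  have key : ∀ {s : Set (X × Y)} {r : ℝ≥0∞}, MeasurableSet s → r ≠ ⊤ →
      ((K.withDensity fun z => ENNReal.ofReal (g z)) s = r ↔ ∫ z in s, g z ∂K = r.toReal) := by
    intro s r hs hr
    rw [withDensity_ofReal_apply hg0 hgi hs, ← ENNReal.toReal_eq_toReal_iff' ofReal_ne_top hr,
      ENNReal.toReal_ofReal (integral_nonneg hg0)]
  rw [Coupling, Set.mem_ofPred_eq, Measure.ext_iff, Measure.ext_iff]
  refine and_congr (forall₂_congr fun A hA => ?_) (forall₂_congr fun B hB => ?_)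
  · rw [Measure.map_apply measurable_fst hA, key (measurable_fst hA) (measure_ne_top _ _)]
    rfl
  · rw [Measure.map_apply measurable_snd hB, key (measurable_snd hB) (measure_ne_top _ _)]
    rfl

/-- An entropy minimizer with given marginals is multiplicatively cyclic. -/
lemma ae_mul_eq_mul_of_minimizer (μ : Measure X) (ν : Measure Y)
    [IsProbabilityMeasure μ] [IsProbabilityMeasure ν] {K : Measure (X × Y)} [IsFiniteMeasure K]
    {k h : X × Y → ℝ} (hk : Measurable k) {κ : ℝ} (hκ : 0 < κ) (hκk : ∀ z, κ ≤ k z)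
    (hK : K = (μ.prod ν).withDensity fun z => ENNReal.ofReal (k z))
    (hh : Measurable h) (hh0 : ∀ z, 0 ≤ h z) (hhi : Integrable h K)
    (hφ : Integrable (fun z => phi (h z)) K)
    (hopt : ∀ g : X × Y → ℝ, Measurable g → (∀ z, 0 ≤ g z) → Integrable g K →
      (∀ A, MeasurableSet A → ∫ z in Prod.fst ⁻¹' A, g z ∂K = ∫ z in Prod.fst ⁻¹' A, h z ∂K) →
      (∀ B, MeasurableSet B → ∫ z in Prod.snd ⁻¹' B, g z ∂K = ∫ z in Prod.snd ⁻¹' B, h z ∂K) →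
      Integrable (fun z => phi (g z)) K → ∫ z, phi (h z) ∂K ≤ ∫ z, phi (g z) ∂K) :
    ∀ᵐ p ∂(μ.prod ν).prod (μ.prod ν), 0 < h p.1 → 0 < h p.2 → 0 < h (p.1.1, p.2.2) →
      0 < h (p.2.1, p.1.2) → h p.1 * h p.2 = h (p.1.1, p.2.2) * h (p.2.1, p.1.2) := by
  have hk0 : ∀ z, 0 < k z := fun z => hκ.trans_le (hκk z)
  set E : ℕ → Set (X × Y) := fun n => {z | ((n : ℝ) + 1)⁻¹ ≤ h z ∧ h z ≤ (n : ℝ) + 1}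
  have hE : ∀ n, MeasurableSet (E n) := fun n =>
    (measurableSet_le measurable_const hh).inter (measurableSet_le hh measurable_const)
  have hn0 : ∀ n : ℕ, (0 : ℝ) < ((n : ℝ) + 1)⁻¹ := fun n => by positivity
  have hbound : ∀ n z, |(E n).indicator (fun z => Real.log (h z)) z| ≤ Real.log ((n : ℝ) + 1) := by
    intro n z
    by_cases hz : z ∈ E n
    · rw [Set.indicator_of_mem hz, abs_le, ← Real.log_inv]
      exact ⟨Real.log_le_log (hn0 n) hz.1, Real.log_le_log ((hn0 n).trans_le hz.1) hz.2⟩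
    · rw [Set.indicator_of_notMem hz, abs_zero]
      exact Real.log_nonneg (by linarith [n.cast_nonneg (α := ℝ)])
  have hmem : ∀ z, 0 < h z → ∀ᶠ n in atTop, z ∈ E n := by
    intro z hz
    obtain ⟨N, hN⟩ := exists_nat_ge (max (h z) (h z)⁻¹)
    filter_upwards [eventually_ge_atTop N] with n hn
    have hn' : (N : ℝ) ≤ n := Nat.cast_le.2 hn
    refine ⟨inv_le_of_inv_le₀ hz ?_, ?_⟩
    · linarith [le_max_right (h z) (h z)⁻¹]
    · linarith [le_max_left (h z) (h z)⁻¹]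
  have hcyc : ∀ n, ∀ᵐ p ∂(μ.prod ν).prod (μ.prod ν), p.1 ∈ E n → p.2 ∈ E n →
      (p.1.1, p.2.2) ∈ E n → (p.2.1, p.1.2) ∈ E n →
      (E n).indicator (fun z => Real.log (h z)) p.1 + (E n).indicator (fun z => Real.log (h z)) p.2
        = (E n).indicator (fun z => Real.log (h z)) (p.1.1, p.2.2) +
          (E n).indicator (fun z => Real.log (h z)) (p.2.1, p.1.2) := by
    intro n
    have hlm : Measurable ((E n).indicator fun z => Real.log (h z)) :=
      (Real.measurable_log.comp hh).indicator (hE n)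
    refine ae_add_eq_add_of_orthogonal μ ν (hE n) hlm (hbound n) fun w hw hwb hwE hwA hwB => ?_
    obtain ⟨C, hC⟩ := hwb
    have hqm : Measurable fun z => w z / k z := hw.div hk
    have hqb : ∀ z, |w z / k z| ≤ (|C| + 1) / κ := fun z => by
      rw [abs_div, abs_of_pos (hk0 z)]
      exact div_le_div₀ (by positivity) (by linarith [hC z, le_abs_self C]) hκ (hκk z)
    have hqi : Integrable (fun z => w z / k z) K := integrable_of_measurable_bound hqm hqb
    have h0 : ∫ z, w z / k z * (E n).indicator (fun z => Real.log (h z)) z ∂K = 0 := by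
      refine integral_mul_log_eq_zero hh hh0 hφ hqm hlm (hn0 n) (by positivity) hqb (hbound n)
        (fun z hz => ?_) fun t ht hti => ?_
      · have hzE : z ∈ E n := by
          by_contra hzE
          exact hz (by rw [hwE z hzE, zero_div])
        exact ⟨hzE.1, Set.indicator_of_mem hzE _⟩
      · have hstrip : ∀ s : Set (X × Y), MeasurableSet s → ∫ z in s, w z ∂μ.prod ν = 0 →
            ∫ z in s, (h z + t * (w z / k z)) ∂K = ∫ z in s, h z ∂K := by
          intro s hs hs0
          rw [integral_add hhi.integrableOn (hqi.const_mul t).integrableOn, integral_const_mul, hK,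
            setIntegral_div_withDensity hk hk0 hs, hs0, mul_zero, add_zero]
        exact hopt _ (hh.add (hqm.const_mul t)) ht (hhi.add (hqi.const_mul t))
          (fun A hA => hstrip _ (measurable_fst hA) (hwA A hA))
          (fun B hB => hstrip _ (measurable_snd hB) (hwB B hB)) hti
    have h1 := setIntegral_div_withDensity (m := μ.prod ν)
      (w := fun z => w z * (E n).indicator (fun z => Real.log (h z)) z) hk hk0 MeasurableSet.univ
    rw [setIntegral_univ, setIntegral_univ, ← hK] at h1
    rw [← h1, ← h0]
    refine integral_congr_ae (.of_forall fun z => ?_)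
    simp only
    ring
  filter_upwards [ae_all_iff.2 hcyc] with p hp h1 h2 h3 h4
  obtain ⟨n, ⟨⟨m1, m2⟩, m3⟩, m4⟩ :=
    ((((hmem _ h1).and (hmem _ h2)).and (hmem _ h3)).and (hmem _ h4)).exists
  have := hp n m1 m2 m3 m4
  rw [Set.indicator_of_mem m1, Set.indicator_of_mem m2, Set.indicator_of_mem m3,
    Set.indicator_of_mem m4, ← Real.log_mul h1.ne' h2.ne', ← Real.log_mul h3.ne' h4.ne'] at this
  exact Real.log_injOn_pos (mul_pos h1 h2) (mul_pos h3 h4) this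

/-- A nonzero multiplicatively cyclic function whose support is a product set is a.e. a tensor
product. -/
lemma exists_ae_eq_mul_of_cyclic (μ : Measure X) (ν : Measure Y) [SFinite μ] [SFinite ν]
    {h : X × Y → ℝ} (hh : Measurable h) (hh0 : ∀ z, 0 ≤ h z) {P : X → Prop} {Q : Y → Prop}
    (hsupp : ∀ᵐ z ∂μ.prod ν, 0 < h z ↔ P z.1 ∧ Q z.2)
    (hne : ∃ᵐ z ∂μ.prod ν, 0 < h z)
    (hcyc : ∀ᵐ p ∂(μ.prod ν).prod (μ.prod ν), 0 < h p.1 → 0 < h p.2 → 0 < h (p.1.1, p.2.2) →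
      0 < h (p.2.1, p.1.2) → h p.1 * h p.2 = h (p.1.1, p.2.2) * h (p.2.1, p.1.2)) :
    ∃ u : X → ℝ, ∃ v : Y → ℝ, Measurable u ∧ Measurable v ∧ (∀ x, 0 ≤ u x) ∧ (∀ y, 0 ≤ v y) ∧
      ∀ᵐ z ∂μ.prod ν, h z = u z.1 * v z.2 := by
  have hcyc' : ∀ᵐ z' ∂μ.prod ν, ∀ᵐ z ∂μ.prod ν, 0 < h z → 0 < h z' → 0 < h (z.1, z'.2) →
      0 < h (z'.1, z.2) → h z * h z' = h (z.1, z'.2) * h (z'.1, z.2) :=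
    Measure.ae_ae_of_ae_prod (Measure.measurePreserving_swap.quasiMeasurePreserving.ae hcyc)
  have hx : ∀ᵐ z' ∂μ.prod ν, ∀ᵐ y ∂ν, 0 < h (z'.1, y) ↔ P z'.1 ∧ Q y :=
    Measure.quasiMeasurePreserving_fst.ae (Measure.ae_ae_of_ae_prod hsupp)
  have hy : ∀ᵐ z' ∂μ.prod ν, ∀ᵐ x ∂μ, 0 < h (x, z'.2) ↔ P x ∧ Q z'.2 :=
    Measure.quasiMeasurePreserving_snd.ae (Measure.ae_ae_of_ae_prod
      (Measure.measurePreserving_swap.quasiMeasurePreserving.ae hsupp))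
  obtain ⟨z', hz', ⟨⟨h1, h2⟩, h3⟩, h4⟩ := (hne.and_eventually
    (((hcyc'.and hx).and hy).and hsupp)).exists
  obtain ⟨hP, hQ⟩ := h4.1 hz'
  refine ⟨fun x => h (x, z'.2) / h z', fun y => h (z'.1, y),
    (hh.comp measurable_prodMk_right).div_const _, hh.comp measurable_prodMk_left,
    fun x => div_nonneg (hh0 _) hz'.le, fun y => hh0 _, ?_⟩
  filter_upwards [h1, hsupp, Measure.quasiMeasurePreserving_snd.ae h2,
    Measure.quasiMeasurePreserving_fst.ae h3] with z g1 g2 g3 g4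
  rw [div_mul_eq_mul_div, eq_div_iff hz'.ne']
  by_cases hz : 0 < h z
  · obtain ⟨hPz, hQz⟩ := g2.1 hz
    exact g1 hz hz' (g4.2 ⟨hPz, hQ⟩) (g3.2 ⟨hP, hQz⟩)
  · have hz0 : h z = 0 := le_antisymm (not_lt.1 hz) (hh0 z)
    rw [hz0, zero_mul, eq_comm, mul_eq_zero]
    by_contra! hcon
    exact hz (g2.2 ⟨(g4.1 ((hh0 _).lt_of_ne' hcon.1)).1, (g3.1 ((hh0 _).lt_of_ne' hcon.2)).2⟩)

/-- The factors of a nonzero tensor product are unique up to a scalar. -/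
lemma exists_scaling_of_ae_mul_eq_mul (μ : Measure X) (ν : Measure Y) [SFinite μ] [SFinite ν]
    {u u' : X → ℝ} {v v' : Y → ℝ}
    (hv : ∀ y, 0 ≤ v y) (hv' : ∀ y, 0 ≤ v' y)
    (hne : ∃ᵐ z ∂μ.prod ν, u z.1 * v z.2 ≠ 0)
    (heq : ∀ᵐ z ∂μ.prod ν, u' z.1 * v' z.2 = u z.1 * v z.2) :
    ∃ lam : ℝ, 0 < lam ∧ (∀ᵐ x ∂μ, u' x = lam * u x) ∧ (∀ᵐ y ∂ν, v' y = lam⁻¹ * v y) := by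
  have hx : ∀ᵐ z' ∂μ.prod ν, ∀ᵐ y ∂ν, u' z'.1 * v' y = u z'.1 * v y :=
    Measure.quasiMeasurePreserving_fst.ae (Measure.ae_ae_of_ae_prod heq)
  have hy : ∀ᵐ z' ∂μ.prod ν, ∀ᵐ x ∂μ, u' x * v' z'.2 = u x * v z'.2 :=
    Measure.quasiMeasurePreserving_snd.ae (Measure.ae_ae_of_ae_prod
      (Measure.measurePreserving_swap.quasiMeasurePreserving.ae heq))
  obtain ⟨⟨x₀, y₀⟩, h0, ⟨h1, h2⟩, h3⟩ := (hne.and_eventually ((hx.and hy).and heq)).exists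
  simp only at h0 h1 h2 h3
  obtain ⟨hu0, hv0⟩ := mul_ne_zero_iff.1 h0
  obtain ⟨hu0', hv0'⟩ := mul_ne_zero_iff.1 (h3 ▸ h0)
  have hlam : u' x₀ = v y₀ / v' y₀ * u x₀ := by
    field_simp
    linarith
  refine ⟨v y₀ / v' y₀, div_pos ((hv _).lt_of_ne' hv0) ((hv' _).lt_of_ne' hv0'), ?_, ?_⟩
  · filter_upwards [h2] with x hx
    field_simp
    linarith
  · filter_upwards [h1] with y hy
    rw [hlam] at hy
    field_simp at hy ⊢
    linarith

end Marginals

/-- Proposition 2.4 (ii): the unique minimizer `π*` has the form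
`π* = (u* ⊗ v*)·K` for measurable nonnegative scaling factors, which are unique
a.e. up to the rescaling `(u*,v*) ↦ (λ u*, λ⁻¹ v*)`, `λ > 0`. -/
theorem scaling_factors_exist_and_unique
    {X Y : Type*} [MetricSpace X] [CompactSpace X] [MeasurableSpace X] [BorelSpace X]
    [MetricSpace Y] [CompactSpace Y] [MeasurableSpace Y] [BorelSpace Y]
    (μ : Measure X) (ν : Measure Y) [IsProbabilityMeasure μ] [IsProbabilityMeasure ν]
    (c : X × Y → ℝ) (hc : Measurable c) (cmax : ℝ)
    (hc0 : ∀ p, 0 ≤ c p) (hcmax : ∀ p, c p ≤ cmax)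
    (ε : ℝ) (hε : 0 < ε)
    (μh : Measure X) (νh : Measure Y)
    (hμac : μh ≪ μ) (hνac : νh ≪ ν)
    (hmass : μh Set.univ = νh Set.univ) (hposmass : 0 < μh Set.univ)
    (hμbd : ∃ C : ℝ≥0∞, C ≠ ⊤ ∧ ∀ᵐ x ∂μ, μh.rnDeriv μ x ≤ C)
    (hνbd : ∃ C : ℝ≥0∞, C ≠ ⊤ ∧ ∀ᵐ y ∂ν, νh.rnDeriv ν y ≤ C)
    (πopt : Measure (X × Y)) (hπopt : πopt ∈ Coupling μh νh)
    (hmin : ∀ π ∈ Coupling μh νh, KL πopt (Kmeas μ ν c ε) ≤ KL π (Kmeas μ ν c ε)) :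
    ∃ u : X → ℝ, ∃ v : Y → ℝ,
      Measurable u ∧ Measurable v ∧ (∀ x, 0 ≤ u x) ∧ (∀ y, 0 ≤ v y) ∧
      πopt = (Kmeas μ ν c ε).withDensity (prodDensity u v) ∧
      (∀ u' : X → ℝ, ∀ v' : Y → ℝ, Measurable u' → Measurable v' →
        (∀ x, 0 ≤ u' x) → (∀ y, 0 ≤ v' y) →
        πopt = (Kmeas μ ν c ε).withDensity (prodDensity u' v') →
        ∃ lam : ℝ, 0 < lam ∧ (∀ᵐ x ∂μ, u' x = lam * u x) ∧
          (∀ᵐ y ∂ν, v' y = lam⁻¹ * v y)) := by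
  obtain ⟨f, Cf, hf, hf0, hfC, rfl⟩ := exists_bounded_density hμac hμbd
  obtain ⟨g, Cg, hg, hg0, hgC, rfl⟩ := exists_bounded_density hνac hνbd
  have hfi : Integrable f μ :=
    integrable_of_measurable_bound hf fun x => (abs_of_nonneg (hf0 x)).le.trans (hfC x)
  have hgi : Integrable g ν :=
    integrable_of_measurable_bound hg fun y => (abs_of_nonneg (hg0 y)).le.trans (hgC y)
  have : IsFiniteMeasure (μ.withDensity fun x => ENNReal.ofReal (f x)) :=
    isFiniteMeasure_withDensity_ofReal hfi.2
  have : IsFiniteMeasure (ν.withDensity fun y => ENNReal.ofReal (g y)) :=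
    isFiniteMeasure_withDensity_ofReal hgi.2
  have hreal_f : ∀ A, MeasurableSet A →
      (μ.withDensity fun x => ENNReal.ofReal (f x)).real A = ∫ x in A, f x ∂μ := fun A hA => by
    rw [Measure.real, withDensity_ofReal_apply hf0 hfi hA,
      ENNReal.toReal_ofReal (integral_nonneg hf0)]
  have hreal_g : ∀ B, MeasurableSet B →
      (ν.withDensity fun y => ENNReal.ofReal (g y)).real B = ∫ y in B, g y ∂ν := fun B hB => by
    rw [Measure.real, withDensity_ofReal_apply hg0 hgi hB,
      ENNReal.toReal_ofReal (integral_nonneg hg0)]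
  set M : ℝ := ∫ x, f x ∂μ with hM
  have hMf : (μ.withDensity fun x => ENNReal.ofReal (f x)) Set.univ = ENNReal.ofReal M := by
    rw [withDensity_ofReal_apply hf0 hfi MeasurableSet.univ, setIntegral_univ]
  have hMpos : 0 < M := by rwa [hMf, ENNReal.ofReal_pos] at hposmass
  have hMg : ∫ y, g y ∂ν = M := by
    rw [hMf, withDensity_ofReal_apply hg0 hgi MeasurableSet.univ, setIntegral_univ] at hmass
    exact ((ENNReal.ofReal_eq_ofReal_iff hMpos.le (integral_nonneg hg0)).1 hmass).symm
  set k : X × Y → ℝ := fun p => Real.exp (-c p / ε)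
  have hk : Measurable k := by fun_prop
  have hk0 : ∀ p, 0 < k p := fun p => Real.exp_pos _
  have hκk : ∀ p, Real.exp (-cmax / ε) ≤ k p := fun p => by
    refine Real.exp_le_exp.2 (div_le_div_of_nonneg_right ?_ hε.le)
    linarith [hcmax p]
  have hk1 : ∀ p, k p ≤ 1 := fun p =>
    Real.exp_le_one_iff.2 (div_nonpos_of_nonpos_of_nonneg (by linarith [hc0 p]) hε.le)
  set K := Kmeas μ ν c ε
  have hK : K = (μ.prod ν).withDensity fun p => ENNReal.ofReal (k p) := rfl
  have hki : Integrable k (μ.prod ν) :=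
    integrable_of_measurable_bound hk fun p => (abs_of_pos (hk0 p)).le.trans (hk1 p)
  have hKfin : IsFiniteMeasure K := isFiniteMeasure_withDensity_ofReal hki.2
  have hae : ∀ {p : X × Y → Prop}, (∀ᵐ z ∂K, p z) ↔ ∀ᵐ z ∂μ.prod ν, p z := by
    intro p
    rw [hK, ae_withDensity_iff hk.ennreal_ofReal]
    simp [hk0]
  -- The normalized product plan is admissible with finite entropy
  set r : X × Y → ℝ := fun p => f p.1 * g p.2 / M / k p
  have hr : Measurable r := by fun_prop
  have hr0 : ∀ p, 0 ≤ r p := fun p =>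
    div_nonneg (div_nonneg (mul_nonneg (hf0 _) (hg0 _)) hMpos.le) (hk0 p).le
  have hrb : ∀ p, r p ≤ Cf * Cg / M / Real.exp (-cmax / ε) := fun p => by
    have hCf : 0 ≤ Cf := (hf0 p.1).trans (hfC p.1)
    have hCg : 0 ≤ Cg := (hg0 p.2).trans (hgC p.2)
    refine div_le_div₀ (by positivity) ?_ (Real.exp_pos _) (hκk p)
    exact div_le_div_of_nonneg_right (mul_le_mul (hfC _) (hgC _) (hg0 _) hCf) hMpos.le
  have hri : Integrable r K :=
    integrable_of_measurable_bound hr fun p => (abs_of_nonneg (hr0 p)).le.trans (hrb p)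
  have hφr : Integrable (fun p => phi (r p)) K := by
    refine integrable_of_measurable_bound (measurable_phi.comp hr)
      (C := (Cf * Cg / M / Real.exp (-cmax / ε)) ^ 2 + 1) fun p => ?_
    rw [abs_of_nonneg (phi_nonneg (hr0 p))]
    have := pow_le_pow_left₀ (hr0 p) (hrb p) 2
    linarith [phi_le_sq (hr0 p), hr0 p, sub_sq (r p) 1]
  have hrint : ∀ (A : Set X) (B : Set Y), MeasurableSet A → MeasurableSet B →
      ∫ z in A ×ˢ B, r z ∂K = (∫ x in A, f x ∂μ) * (∫ y in B, g y ∂ν) / M := by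
    intro A B hA hB
    rw [hK, setIntegral_div_withDensity hk hk0 (hA.prod hB), integral_div, setIntegral_prod_mul]
  have hrcoup : (∀ A, MeasurableSet A → ∫ z in Prod.fst ⁻¹' A, r z ∂K = ∫ x in A, f x ∂μ) ∧
      (∀ B, MeasurableSet B → ∫ z in Prod.snd ⁻¹' B, r z ∂K = ∫ y in B, g y ∂ν) := by
    refine ⟨fun A hA => ?_, fun B hB => ?_⟩
    · rw [← Set.prod_univ, hrint A _ hA MeasurableSet.univ, setIntegral_univ, hMg,
        mul_div_cancel_right₀ _ hMpos.ne']
    · rw [← Set.univ_prod, hrint _ B MeasurableSet.univ hB, setIntegral_univ, ← hM,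
        mul_div_cancel_left₀ _ hMpos.ne']
  have hcoup : ∀ {q : X × Y → ℝ}, (∀ z, 0 ≤ q z) → Integrable q K →
      ((K.withDensity fun z => ENNReal.ofReal (q z)) ∈
        Coupling (μ.withDensity fun x => ENNReal.ofReal (f x))
          (ν.withDensity fun y => ENNReal.ofReal (g y)) ↔
      (∀ A, MeasurableSet A → ∫ z in Prod.fst ⁻¹' A, q z ∂K = ∫ x in A, f x ∂μ) ∧
      (∀ B, MeasurableSet B → ∫ z in Prod.snd ⁻¹' B, q z ∂K = ∫ y in B, g y ∂ν)) := by
    intro q hq0 hqi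
    rw [withDensity_mem_Coupling_iff hq0 hqi]
    exact and_congr (forall₂_congr fun A hA => by rw [hreal_f A hA])
      (forall₂_congr fun B hB => by rw [hreal_g B hB])
  have hKLr : KL (K.withDensity fun z => ENNReal.ofReal (r z)) K ≠ ⊤ := by
    rw [KL_withDensity hr hr0,
      ← ofReal_integral_eq_lintegral_ofReal hφr (.of_forall fun z => phi_nonneg (hr0 z))]
    exact ENNReal.ofReal_ne_top
  have hac : πopt ≪ K := by
    by_contra hac
    have h1 := hmin _ ((hcoup hr0 hri).2 hrcoup)
    rw [KL, if_neg hac, top_le_iff] at h1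
    exact hKLr h1
  have hπfin : IsFiniteMeasure πopt := by
    constructor
    have h1 := congrArg (fun ρ => ρ Set.univ) hπopt.1
    simp only [Measure.map_apply measurable_fst MeasurableSet.univ, Set.preimage_univ] at h1
    rw [h1]
    exact measure_lt_top _ _
  -- The density of the minimizer
  set h : X × Y → ℝ := fun z => (πopt.rnDeriv K z).toReal
  have hh : Measurable h := (Measure.measurable_rnDeriv _ _).ennreal_toReal
  have hh0 : ∀ z, 0 ≤ h z := fun z => toReal_nonneg
  have hhi : Integrable h K := Measure.integrable_toReal_rnDeriv
  have hπ : πopt = K.withDensity fun z => ENNReal.ofReal (h z) := by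
    have := Measure.haveLebesgueDecomposition_of_sigmaFinite πopt K
    conv_lhs => rw [← Measure.withDensity_rnDeriv_eq πopt K hac]
    refine withDensity_congr_ae ?_
    filter_upwards [Measure.rnDeriv_lt_top πopt K] with z hz
    rw [ENNReal.ofReal_toReal hz.ne]
  obtain ⟨hhfst, hhsnd⟩ := (hcoup hh0 hhi).1 (hπ ▸ hπopt)
  have hopt : ∀ q : X × Y → ℝ, Measurable q → (∀ z, 0 ≤ q z) → Integrable q K →
      (∀ A, MeasurableSet A → ∫ z in Prod.fst ⁻¹' A, q z ∂K = ∫ z in Prod.fst ⁻¹' A, h z ∂K) →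
      (∀ B, MeasurableSet B → ∫ z in Prod.snd ⁻¹' B, q z ∂K = ∫ z in Prod.snd ⁻¹' B, h z ∂K) →
      Integrable (fun z => phi (q z)) K →
      Integrable (fun z => phi (h z)) K ∧ ∫ z, phi (h z) ∂K ≤ ∫ z, phi (q z) ∂K := by
    intro q hq hq0 hqi hqA hqB hφq
    have h1 := hmin _ ((hcoup hq0 hqi).2 ⟨fun A hA => (hqA A hA).trans (hhfst A hA),
      fun B hB => (hqB B hB).trans (hhsnd B hB)⟩)
    rw [hπ, KL_withDensity hh hh0, KL_withDensity hq hq0] at h1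
    exact integrable_phi_and_integral_le hh hh0 hq0 hφq h1
  have hφh : Integrable (fun z => phi (h z)) K :=
    (hopt r hr hr0 hri (fun A hA => (hrcoup.1 A hA).trans (hhfst A hA).symm)
      (fun B hB => (hrcoup.2 B hB).trans (hhsnd B hB).symm) hφr).1
  have hpos : ∀ᵐ z ∂K, h z = 0 → r z = 0 := by
    refine ae_eq_zero_of_minimizer hh hh0 hφh hr hr0 hri hφr fun t ht ht1 hti => ?_
    have hmix : ∀ s : Set (X × Y), ∫ z in s, r z ∂K = ∫ z in s, h z ∂K →
        ∫ z in s, ((1 - t) * h z + t * r z) ∂K = ∫ z in s, h z ∂K := by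
      intro s hs
      rw [integral_add (hhi.const_mul _).integrableOn (hri.const_mul t).integrableOn,
        integral_const_mul, integral_const_mul, hs]
      ring
    exact (hopt _ ((hh.const_mul _).add (hr.const_mul t))
      (fun z => add_nonneg (mul_nonneg (sub_nonneg.2 ht1) (hh0 z)) (mul_nonneg ht.le (hr0 z)))
      ((hhi.const_mul _).add (hri.const_mul t))
      (fun A hA => hmix _ ((hrcoup.1 A hA).trans (hhfst A hA).symm))
      (fun B hB => hmix _ ((hrcoup.2 B hB).trans (hhsnd B hB).symm)) hti).2
  have hzero : ∀ s : Set (X × Y), MeasurableSet s → ∫ z in s, h z ∂K = 0 →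
      ∀ᵐ z ∂K, z ∈ s → h z = 0 := by
    intro s hs h1
    rw [setIntegral_eq_zero_iff_of_nonneg_ae (.of_forall hh0) hhi.integrableOn] at h1
    exact (ae_restrict_iff' hs).1 h1
  have hzf : ∀ᵐ z ∂K, z.1 ∈ {x | f x = 0} → h z = 0 := by
    have hA : MeasurableSet {x | f x = 0} := hf (measurableSet_singleton 0)
    exact hzero _ (measurable_fst hA) ((hhfst _ hA).trans
      (setIntegral_eq_zero_of_forall_eq_zero fun x hx => hx))
  have hzg : ∀ᵐ z ∂K, z.2 ∈ {y | g y = 0} → h z = 0 := by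
    have hB : MeasurableSet {y | g y = 0} := hg (measurableSet_singleton 0)
    exact hzero _ (measurable_snd hB) ((hhsnd _ hB).trans
      (setIntegral_eq_zero_of_forall_eq_zero fun y hy => hy))
  have hsupp : ∀ᵐ z ∂μ.prod ν, 0 < h z ↔ 0 < f z.1 ∧ 0 < g z.2 := by
    rw [← hae]
    filter_upwards [hpos, hzf, hzg] with z h1 h2 h3
    refine ⟨fun hz => ⟨(hf0 _).lt_of_ne' fun h0 => hz.ne' (h2 h0),
      (hg0 _).lt_of_ne' fun h0 => hz.ne' (h3 h0)⟩, fun hz => (hh0 z).lt_of_ne' fun h0 => ?_⟩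
    exact (div_pos (div_pos (mul_pos hz.1 hz.2) hMpos) (hk0 z)).ne' (h1 h0)
  have hne : ∃ᵐ z ∂μ.prod ν, 0 < h z := by
    intro hcon
    have h1 := hhfst Set.univ MeasurableSet.univ
    rw [Set.preimage_univ, setIntegral_univ, setIntegral_univ, ← hM] at h1
    refine hMpos.ne' (h1 ▸ integral_eq_zero_of_ae ?_)
    filter_upwards [hae.2 hcon] with z hz
    exact le_antisymm (not_lt.1 hz) (hh0 z)
  have hcyc := ae_mul_eq_mul_of_minimizer μ ν hk (Real.exp_pos _) hκk hK hh hh0 hhi hφh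
    fun q hq hq0 hqi hqA hqB hφq => (hopt q hq hq0 hqi hqA hqB hφq).2
  obtain ⟨u, v, hu, hv, hu0, hv0, huv⟩ :=
    exists_ae_eq_mul_of_cyclic μ ν (P := fun x => 0 < f x) (Q := fun y => 0 < g y) hh hh0 hsupp
      hne hcyc
  have huv' : ∀ {a : X → ℝ} {b : Y → ℝ}, Measurable a → Measurable b → (∀ x, 0 ≤ a x) →
      (∀ y, 0 ≤ b y) → (πopt = K.withDensity (prodDensity a b) ↔
        ∀ᵐ z ∂μ.prod ν, h z = a z.1 * b z.2) := by
    intro a b ha hb ha0 hb0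
    have hm : Measurable (prodDensity a b) :=
      ((ha.comp measurable_fst).mul (hb.comp measurable_snd)).ennreal_ofReal
    rw [hπ, withDensity_eq_iff_of_sigmaFinite hh.ennreal_ofReal.aemeasurable hm.aemeasurable,
      ← hae]
    refine eventually_congr (.of_forall fun z => ?_)
    exact ENNReal.ofReal_eq_ofReal_iff (hh0 z) (mul_nonneg (ha0 _) (hb0 _))
  refine ⟨u, v, hu, hv, hu0, hv0, (huv' hu hv hu0 hv0).2 huv,
    fun u' v' hu' hv' hu0' hv0' hπ' => ?_⟩
  refine exists_scaling_of_ae_mul_eq_mul μ ν hv0 hv0' ?_ ?_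
  · exact (hne.and_eventually huv).mono fun z hz => (hz.2 ▸ hz.1).ne'
  · filter_upwards [huv, (huv' hu' hv' hu0' hv0').1 hπ'] with z h1 h2
    exact h2.symm.trans h1
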